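/- Let d ≥ 1, let r ≥ 1 be an integer, let a ∈ ℝ and ν > 0. There is a constant C depending only on a and d such that for all x ∈ ℤ^d with ‖x‖_∞ ≤ r/2: Σ_{u∈ℤ^d, u≠0} ⟨x+ru⟩^{−(d−a)} e^{−ν‖x+ru‖_∞} ≤ C e^{−νr/4} r^{−(d+a_−)} ν^{−a_+} if a ≠ 0, and Σ_{u∈ℤ^d, u≠0} ⟨x+ru⟩^{−d} e^{−ν‖x+ru‖_∞} ≤ C e^{−νr/4} r^{−d} (1 + |log(νr)|) if a = 0, where a_+ = max{a,0} and a_− = max{−a,0}. -/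

import Mathlib

open scoped BigOperators

/-- A unit step in `ℤ^d`: a coordinate direction together with a sign. -/
def wsawStep (d : ℕ) (e : Fin d × Bool) : Fin d → ℤ :=
  fun i => if i = e.1 then (if e.2 then 1 else -1) else 0

/-- The position after `k` steps of the walk on `ℤ^d` with step sequence `s`.
(An `n`-step nearest-neighbour walk on `ℤ^d` started at `0` is the same thing as a
sequence of `n` unit steps.) -/
def wsawPos {d n : ℕ} (s : Fin n → Fin d × Bool) (k : ℕ) : Fin d → ℤ :=
  ∑ j ∈ Finset.univ.filter (fun j : Fin n => (j : ℕ) < k), wsawStep d (s j)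

/-- The weakly self-avoiding walk weight `∏_{0 ≤ s < t ≤ n} (1 + β U_{st}(ω))`
of the `ℤ^d` walk with step sequence `s`. -/
noncomputable def wsawWeight {d : ℕ} (β : ℝ) (n : ℕ) (s : Fin n → Fin d × Bool) : ℝ :=
  ∏ p ∈ (Finset.range (n + 1) ×ˢ Finset.range (n + 1)).filter (fun p => p.1 < p.2),
    (1 + β * (if wsawPos s p.1 = wsawPos s p.2 then (-1 : ℝ) else 0))

/-- The two-point partition function `c_n(x)` on `ℤ^d`. -/
noncomputable def cZx (d : ℕ) (β : ℝ) (n : ℕ) (x : Fin d → ℤ) : ℝ :=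
  ∑ s ∈ Finset.univ.filter (fun s : Fin n → Fin d × Bool => wsawPos s n = x),
    wsawWeight β n s

/-- The partition function `c_n = Σ_x c_n(x)` on `ℤ^d`. -/
noncomputable def cZ (d : ℕ) (β : ℝ) (n : ℕ) : ℝ :=
  ∑ s : Fin n → Fin d × Bool, wsawWeight β n s

/-- The position after `k` steps of the torus walk with step sequence `s`:
the mod-`r` projection of the `ℤ^d` position (for `r ≥ 3`, `n`-step torus walks
started at `0` correspond bijectively to step sequences). -/
def wsawPosT {d : ℕ} (r : ℕ) {n : ℕ} (s : Fin n → Fin d × Bool) (k : ℕ) : Fin d → ZMod r :=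
  fun i => ((wsawPos s k i : ℤ) : ZMod r)

/-- The weakly self-avoiding walk weight of the torus walk with step sequence `s`. -/
noncomputable def wsawWeightT {d : ℕ} (r : ℕ) (β : ℝ) (n : ℕ) (s : Fin n → Fin d × Bool) : ℝ :=
  ∏ p ∈ (Finset.range (n + 1) ×ˢ Finset.range (n + 1)).filter (fun p => p.1 < p.2),
    (1 + β * (if wsawPosT r s p.1 = wsawPosT r s p.2 then (-1 : ℝ) else 0))

/-- The torus partition function `c_n^𝕋`. -/
noncomputable def cT (d r : ℕ) (β : ℝ) (n : ℕ) : ℝ :=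
  ∑ s : Fin n → Fin d × Bool, wsawWeightT r β n s

/-- `μ` is the growth constant: `μ = lim_{n→∞} c_n^{1/n}`. -/
def HasGrowthConst (d : ℕ) (β μ : ℝ) : Prop :=
  Filter.Tendsto (fun n : ℕ => (cZ d β n) ^ ((n : ℝ)⁻¹)) Filter.atTop (nhds μ)

/-- The susceptibility `χ(z)` on `ℤ^d`, for complex `z`. -/
noncomputable def chi (d : ℕ) (β : ℝ) (z : ℂ) : ℂ := ∑' n : ℕ, (cZ d β n : ℂ) * z ^ n

/-- The susceptibility `χ(z)` on `ℤ^d`, for real `z`. -/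
noncomputable def chiR (d : ℕ) (β : ℝ) (z : ℝ) : ℝ := ∑' n : ℕ, cZ d β n * z ^ n

/-- The torus susceptibility `χ^𝕋(z)`, for complex `z`. -/
noncomputable def chiT (d r : ℕ) (β : ℝ) (z : ℂ) : ℂ := ∑' n : ℕ, (cT d r β n : ℂ) * z ^ n

/-- The torus susceptibility `χ^𝕋(z)`, for real `z`. -/
noncomputable def chiTR (d r : ℕ) (β : ℝ) (z : ℝ) : ℝ := ∑' n : ℕ, cT d r β n * z ^ n

/-- The sup norm `‖x‖_∞` of `x ∈ ℤ^d`, as a real number. -/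
noncomputable def nInf {d : ℕ} (x : Fin d → ℤ) : ℝ :=
  ((Finset.univ.sup fun i => (x i).natAbs : ℕ) : ℝ)

/-- `⟨x⟩ = max {1, ‖x‖_∞}`. -/
noncomputable def vee {d : ℕ} (x : Fin d → ℤ) : ℝ := max 1 (nInf x)

/-- The two-point function `G_z(x) = Σ_n c_n(x) z^n` on `ℤ^d`. -/
noncomputable def Gpt (d : ℕ) (β z : ℝ) (x : Fin d → ℤ) : ℝ := ∑' n : ℕ, cZx d β n x * z ^ n

/-- The bubble diagram `B_z = G_z * G_z`. -/
noncomputable def Bpt (d : ℕ) (β z : ℝ) (x : Fin d → ℤ) : ℝ :=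
  ∑' y : Fin d → ℤ, Gpt d β z (x - y) * Gpt d β z y

/-- The triangle diagram `T_z = G_z * G_z * G_z`. -/
noncomputable def Tpt (d : ℕ) (β z : ℝ) (x : Fin d → ℤ) : ℝ :=
  ∑' y : Fin d → ℤ, Bpt d β z (x - y) * Gpt d β z y

/-- The representative in `[-r/2, r/2) ∩ ℤ` of `x ∈ ℤ/rℤ`. -/
def repC (r : ℕ) (x : ZMod r) : ℤ :=
  if 2 * (x.val : ℤ) < (r : ℤ) then (x.val : ℤ) else (x.val : ℤ) - (r : ℤ)

lemma nInf_nonneg {d : ℕ} (x : Fin d → ℤ) : 0 ≤ nInf x := Nat.cast_nonneg _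

lemma abs_le_nInf {d : ℕ} (x : Fin d → ℤ) (i : Fin d) : |(x i : ℝ)| ≤ nInf x := by
  have h : (x i).natAbs ≤ Finset.univ.sup fun i => (x i).natAbs :=
    Finset.le_sup (f := fun i => (x i).natAbs) (Finset.mem_univ i)
  rw [← Int.cast_abs, Int.abs_eq_natAbs, Int.cast_natCast]
  exact Nat.cast_le.mpr h

lemma nInf_le {d : ℕ} (x : Fin d → ℤ) {c : ℝ} (hc : 0 ≤ c) (h : ∀ i, |(x i : ℝ)| ≤ c) :
    nInf x ≤ c := by
  unfold nInf
  rw [← Nat.le_floor_iff hc]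
  refine Finset.sup_le fun i _ => ?_
  rw [Nat.le_floor_iff hc]
  refine le_trans (le_of_eq ?_) (h i)
  rw [← Int.cast_abs, Int.abs_eq_natAbs, Int.cast_natCast]

lemma nInf_shift_le {d r : ℕ} (x u : Fin d → ℤ) :
    nInf (fun i => x i + (r : ℤ) * u i) ≤ r * nInf u + nInf x := by
  have hu := nInf_nonneg u
  have hx := nInf_nonneg x
  refine nInf_le _ (by positivity) fun i => ?_
  push_cast
  refine (abs_add_le _ _).trans ?_
  rw [abs_mul, Nat.abs_cast, add_comm]
  gcongr
  · exact abs_le_nInf u i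
  · exact abs_le_nInf x i

lemma le_nInf_shift {d r : ℕ} (hr : 1 ≤ r) (x u : Fin d → ℤ) :
    r * nInf u - nInf x ≤ nInf (fun i => x i + (r : ℤ) * u i) := by
  set y : Fin d → ℤ := fun i => x i + (r : ℤ) * u i with hy
  have hr' : (0 : ℝ) < r := by exact_mod_cast hr
  have h : nInf u ≤ (nInf y + nInf x) / r := by
    refine nInf_le u (div_nonneg (add_nonneg (nInf_nonneg y) (nInf_nonneg x)) hr'.le) fun i => ?_
    rw [le_div_iff₀ hr']
    have e : (u i : ℝ) * r = y i - x i := by simp [hy]; ring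
    rw [← Nat.abs_cast r, ← abs_mul, e]
    exact (abs_sub _ _).trans (add_le_add (abs_le_nInf y i) (abs_le_nInf x i))
  rw [le_div_iff₀ hr'] at h
  linarith

/-- The sphere of radius `k ≥ 1` in `ℤ^d` has at most `2 d 3^{d-1} k^{d-1}` points. -/
lemma card_sphere_le {d k : ℕ} (hk : 1 ≤ k) (s : Finset (Fin d → ℤ))
    (hs : ∀ u ∈ s, (Finset.univ.sup fun i => (u i).natAbs) = k) :
    s.card ≤ d * (2 * (3 * k) ^ (d - 1)) := by
  let t : Fin d → Fin d → Finset ℤ := fun i j =>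
    if j = i then {(k : ℤ), -(k : ℤ)} else Finset.Icc (-(k : ℤ)) k
  have hsub : s ⊆ Finset.univ.biUnion fun i => Fintype.piFinset (t i) := by
    intro u hu
    have hle : ∀ j, (u j).natAbs ≤ k := fun j => by
      rw [← hs u hu]
      exact Finset.le_sup (f := fun i => (u i).natAbs) (Finset.mem_univ j)
    have hex : ∃ i, (u i).natAbs = k := by
      by_contra! hne
      have hlt : (Finset.univ.sup fun i => (u i).natAbs) < k :=
        (Finset.sup_lt_iff (show ⊥ < k from hk)).2 fun i _ => lt_of_le_of_ne (hle i) (hne i)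
      exact hlt.ne (hs u hu)
    obtain ⟨i, hi⟩ := hex
    simp only [Finset.mem_biUnion, Finset.mem_univ, true_and, Fintype.mem_piFinset]
    refine ⟨i, fun j => ?_⟩
    have := hle j
    by_cases hj : j = i
    · subst hj
      simp only [t, if_true, Finset.mem_insert, Finset.mem_singleton]
      omega
    · simp only [t, hj, if_false, Finset.mem_Icc]
      omega
  have hcard : ∀ i : Fin d, (Fintype.piFinset (t i)).card ≤ 2 * (3 * k) ^ (d - 1) := fun i => by
    rw [Fintype.card_piFinset, ← Finset.mul_prod_erase _ _ (Finset.mem_univ i)]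
    refine Nat.mul_le_mul ?_ ?_
    · simp only [t, if_true]
      exact Finset.card_le_two
    · refine (Finset.prod_le_pow_card _ _ (3 * k) fun j hj => ?_).trans (by simp)
      simp only [t, Finset.ne_of_mem_erase hj, if_false, Int.card_Icc]
      omega
  calc s.card ≤ _ := Finset.card_le_card hsub
    _ ≤ _ := Finset.card_biUnion_le_card_mul _ _ _ fun i _ => hcard i
    _ = _ := by simp

/-- A sum of a radial function over nonzero lattice points is bounded by a one-dimensional sum. -/
lemma exists_radial_sum_le (d : ℕ) (s : Finset {u : Fin d → ℤ // u ≠ 0}) :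
    ∃ T : Finset ℕ, (∀ k ∈ T, 1 ≤ k) ∧ ∀ F : ℕ → ℝ, (∀ k, 0 ≤ F k) →
      ∑ u ∈ s, F (Finset.univ.sup fun i => (u.1 i).natAbs) ≤
        ∑ k ∈ T, (d * (2 * (3 * k) ^ (d - 1)) : ℕ) * F k := by
  classical
  let g : {u : Fin d → ℤ // u ≠ 0} → ℕ := fun u => Finset.univ.sup fun i => (u.1 i).natAbs
  have hg : ∀ u, 1 ≤ g u := by
    intro u
    by_contra! h
    apply u.2
    funext i
    have : (u.1 i).natAbs ≤ g u :=
      Finset.le_sup (f := fun i => (u.1 i).natAbs) (Finset.mem_univ i)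
    simp only [Pi.zero_apply]
    omega
  have hT : ∀ k ∈ s.image g, 1 ≤ k := by
    intro k hk
    obtain ⟨u, -, rfl⟩ := Finset.mem_image.1 hk
    exact hg u
  refine ⟨s.image g, hT, fun F hF => ?_⟩
  rw [Finset.sum_comp F g]
  refine Finset.sum_le_sum fun k hk => ?_
  rw [nsmul_eq_mul]
  refine mul_le_mul_of_nonneg_right (Nat.cast_le.2 ?_) (hF k)
  rw [← Finset.card_map (Function.Embedding.subtype _)]
  refine card_sphere_le (hT k hk) _ fun u hu => ?_
  obtain ⟨v, hv, rfl⟩ := Finset.mem_map.1 hu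
  exact (Finset.mem_filter.1 hv).2

lemma sum_le_sum_range_succ {T : Finset ℕ} {N : ℕ} (hT : ∀ k ∈ T, 1 ≤ k ∧ k ≤ N) {f : ℕ → ℝ}
    (hf : ∀ k, 0 ≤ f k) : ∑ k ∈ T, f k ≤ ∑ j ∈ Finset.range N, f (j + 1) := by
  rw [Finset.range_eq_Ico, Finset.sum_Ico_add' f 0 N 1]
  exact Finset.sum_le_sum_of_subset_of_nonneg
    (fun k hk => Finset.mem_Ico.2 ⟨(hT k hk).1, Nat.lt_succ_of_le (hT k hk).2⟩)
    fun k _ _ => hf k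

lemma sum_exp_le {t : ℝ} (ht : 0 < t) {T : Finset ℕ} (hT : ∀ k ∈ T, 1 ≤ k) :
    ∑ k ∈ T, Real.exp (-t * k) ≤ t⁻¹ := by
  have hT' : ∀ k ∈ T, 1 ≤ k ∧ k ≤ T.sup id := fun k hk => ⟨hT k hk, Finset.le_sup (f := id) hk⟩
  refine (sum_le_sum_range_succ hT' fun k => (Real.exp_pos _).le).trans ?_
  have h : ∀ j : ℕ, Real.exp (-t * (j + 1 : ℕ)) ≤
      t⁻¹ * (Real.exp (-t * j) - Real.exp (-t * (j + 1 : ℕ))) := by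
    intro j
    have e : Real.exp (-t * j) = Real.exp t * Real.exp (-t * (j + 1 : ℕ)) := by
      rw [← Real.exp_add]; congr 1; push_cast; ring
    have h1 := Real.add_one_le_exp t
    have h2 := Real.exp_pos (-t * (j + 1 : ℕ))
    rw [inv_mul_eq_div, le_div_iff₀ ht, e]
    nlinarith
  refine (Finset.sum_le_sum fun j _ => h j).trans ?_
  rw [← Finset.mul_sum, Finset.sum_range_sub' (fun j : ℕ => Real.exp (-t * j))]
  refine mul_le_of_le_one_right (inv_pos.2 ht).le ?_
  have := Real.exp_pos (-t * (T.sup id : ℕ))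
  simp only [Nat.cast_zero, mul_zero, Real.exp_zero]
  linarith

lemma sum_rpow_mul_exp_tail_le {a t : ℝ} (ha : a ≤ 1) (ht : 0 < t) {T : Finset ℕ}
    (hT : ∀ k ∈ T, 1 ≤ k) (hlarge : ∀ k ∈ T, t⁻¹ ≤ k) :
    ∑ k ∈ T, (k : ℝ) ^ (a - 1) * Real.exp (-t * k) ≤ t ^ (-a) := by
  have h : ∀ k ∈ T, (k : ℝ) ^ (a - 1) * Real.exp (-t * k) ≤
      t ^ (1 - a) * Real.exp (-t * k) := fun k hk => by
    have := Real.rpow_le_rpow_of_nonpos (inv_pos.2 ht) (hlarge k hk) (by linarith : a - 1 ≤ 0)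
    rw [Real.inv_rpow ht.le, ← Real.rpow_neg ht.le, neg_sub] at this
    gcongr
  refine (Finset.sum_le_sum h).trans ?_
  rw [← Finset.mul_sum]
  refine (mul_le_mul_of_nonneg_left (sum_exp_le ht hT) (by positivity)).trans (le_of_eq ?_)
  rw [← Real.rpow_neg_one, ← Real.rpow_add ht]
  congr 1; ring

lemma sum_rpow_sub_one_le {a y : ℝ} (ha : 0 < a) (ha1 : a ≤ 1) (hy : 0 ≤ y) {T : Finset ℕ}
    (hT : ∀ k ∈ T, 1 ≤ k) (hsmall : ∀ k ∈ T, (k : ℝ) ≤ y) :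
    ∑ k ∈ T, (k : ℝ) ^ (a - 1) ≤ a⁻¹ * y ^ a := by
  have hT' : ∀ k ∈ T, 1 ≤ k ∧ k ≤ ⌊y⌋₊ := fun k hk => ⟨hT k hk, Nat.le_floor (hsmall k hk)⟩
  refine (sum_le_sum_range_succ hT' fun k => by positivity).trans ?_
  have h : ∀ j : ℕ, ((j + 1 : ℕ) : ℝ) ^ (a - 1) ≤
      a⁻¹ * (((j + 1 : ℕ) : ℝ) ^ a - (j : ℝ) ^ a) := by
    intro j
    set m : ℝ := ((j + 1 : ℕ) : ℝ) with hm
    have hm1 : 1 ≤ m := by rw [hm]; push_cast; linarith [(Nat.cast_nonneg j : (0 : ℝ) ≤ j)]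
    have hm0 : 0 < m := by linarith
    have hinv : m⁻¹ ≤ 1 := inv_le_one_of_one_le₀ hm1
    have hj : (j : ℝ) = m * (1 + -m⁻¹) := by
      rw [mul_add, mul_neg, mul_inv_cancel₀ hm0.ne', hm]
      push_cast; ring
    have hb := rpow_one_add_le_one_add_mul_self (by linarith : -1 ≤ -m⁻¹) ha.le ha1
    rw [hj, Real.mul_rpow hm0.le (by linarith), Real.rpow_sub_one hm0.ne', inv_mul_eq_div,
      le_div_iff₀ ha]
    have hp : 0 < m ^ a := by positivity
    have := mul_le_mul_of_nonneg_left hb hp.le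
    have e : m ^ a / m * a = m ^ a * (a * m⁻¹) := by ring
    rw [e]
    linarith
  refine (Finset.sum_le_sum fun j _ => h j).trans ?_
  rw [← Finset.mul_sum, Finset.sum_range_sub (fun j : ℕ => (j : ℝ) ^ a), Nat.cast_zero,
    Real.zero_rpow ha.ne', sub_zero]
  gcongr
  exact Nat.floor_le hy

lemma sum_rpow_mul_exp_le_split {a t : ℝ} (ha : a ≤ 1) (ht : 0 < t) {T : Finset ℕ}
    (hT : ∀ k ∈ T, 1 ≤ k) :
    ∑ k ∈ T, (k : ℝ) ^ (a - 1) * Real.exp (-t * k) ≤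
      ∑ k ∈ T.filter (fun k : ℕ => (k : ℝ) ≤ t⁻¹), (k : ℝ) ^ (a - 1) + t ^ (-a) := by
  rw [← Finset.sum_filter_add_sum_filter_not T (fun k : ℕ => (k : ℝ) ≤ t⁻¹)]
  refine add_le_add (Finset.sum_le_sum fun k _ => ?_) ?_
  · refine mul_le_of_le_one_right (by positivity) (Real.exp_le_one_iff.2 ?_)
    have : 0 ≤ t * k := by positivity
    linarith
  · refine sum_rpow_mul_exp_tail_le ha ht (fun k hk => hT k (Finset.mem_filter.1 hk).1)
      fun k hk => ?_
    exact (not_le.1 (Finset.mem_filter.1 hk).2).le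

lemma rpow_mul_exp_neg_le {b y : ℝ} (hb : 0 < b) (hy : 0 < y) :
    y ^ b * Real.exp (-y) ≤ b ^ b := by
  have h : y / b ≤ Real.exp (y / b) := by linarith [Real.add_one_le_exp (y / b)]
  have h2 : (y / b) ^ b ≤ Real.exp y := by
    refine (Real.rpow_le_rpow (by positivity) h hb.le).trans (le_of_eq ?_)
    rw [← Real.exp_mul, div_mul_cancel₀ _ hb.ne']
  rw [Real.div_rpow hy.le hb.le, div_le_iff₀ (by positivity)] at h2
  rw [Real.exp_neg, ← div_eq_mul_inv, div_le_iff₀ (Real.exp_pos y)]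
  linarith

lemma exists_sum_rpow_mul_exp_le_of_pos {a : ℝ} (ha : 0 < a) :
    ∃ C : ℝ, 0 < C ∧ ∀ t : ℝ, 0 < t → ∀ T : Finset ℕ, (∀ k ∈ T, 1 ≤ k) →
      ∑ k ∈ T, (k : ℝ) ^ (a - 1) * Real.exp (-t * k) ≤ C * t ^ (-a) := by
  rcases le_or_gt a 1 with ha1 | ha1
  · refine ⟨a⁻¹ + 1, by positivity, fun t ht T hT => ?_⟩
    refine (sum_rpow_mul_exp_le_split ha1 ht hT).trans ?_
    have := sum_rpow_sub_one_le ha ha1 (inv_pos.2 ht).le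
      (T := T.filter fun k : ℕ => (k : ℝ) ≤ t⁻¹) (fun k hk => hT k (Finset.mem_filter.1 hk).1)
      fun k hk => (Finset.mem_filter.1 hk).2
    rw [Real.inv_rpow ht.le, ← Real.rpow_neg ht.le] at this
    linarith
  · set b := a - 1 with hb
    have hb0 : 0 < b := by linarith
    refine ⟨b ^ b * 2 ^ b * 2, by positivity, fun t ht T hT => ?_⟩
    have h : ∀ k ∈ T, (k : ℝ) ^ b * Real.exp (-t * k) ≤
        (b ^ b * 2 ^ b * t ^ (-b)) * Real.exp (-(t / 2) * k) := fun k hk => by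
      have hk0 : (0 : ℝ) < k := by exact_mod_cast hT k hk
      have h1 := rpow_mul_exp_neg_le hb0 (show 0 < t / 2 * k by positivity)
      rw [Real.mul_rpow (by positivity) hk0.le, Real.div_rpow ht.le (by norm_num)] at h1
      have e : Real.exp (-t * k) = Real.exp (-(t / 2 * k)) * Real.exp (-(t / 2) * k) := by
        rw [← Real.exp_add]; congr 1; ring
      rw [e, ← mul_assoc]
      refine mul_le_mul_of_nonneg_right ?_ (Real.exp_pos _).le
      rw [Real.rpow_neg ht.le, ← div_eq_mul_inv, le_div_iff₀ (by positivity)]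
      have h2 := mul_le_mul_of_nonneg_right h1 (show 0 ≤ (2 : ℝ) ^ b by positivity)
      refine le_trans (le_of_eq ?_) h2
      field_simp
    refine (Finset.sum_le_sum h).trans ?_
    rw [← Finset.mul_sum]
    refine (mul_le_mul_of_nonneg_left (sum_exp_le (half_pos ht) hT) (by positivity)).trans
      (le_of_eq ?_)
    have e : t ^ (-a) = t ^ (-b) * t⁻¹ := by
      rw [← Real.rpow_neg_one t, ← Real.rpow_add ht]; congr 1; rw [hb]; ring
    rw [e, inv_div]
    ring

lemma exists_sum_rpow_mul_exp_le_of_neg {a : ℝ} (ha : a < 0) :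
    ∃ C : ℝ, 0 < C ∧ ∀ t : ℝ, 0 < t → ∀ T : Finset ℕ,
      ∑ k ∈ T, (k : ℝ) ^ (a - 1) * Real.exp (-t * k) ≤ C := by
  have hs : Summable fun k : ℕ => (k : ℝ) ^ (a - 1) := Real.summable_nat_rpow.2 (by linarith)
  have h0 : 0 ≤ ∑' k : ℕ, (k : ℝ) ^ (a - 1) := tsum_nonneg fun k => by positivity
  refine ⟨∑' k : ℕ, (k : ℝ) ^ (a - 1) + 1, by positivity, fun t ht T => ?_⟩
  have h1 : ∑ k ∈ T, (k : ℝ) ^ (a - 1) ≤ ∑' k : ℕ, (k : ℝ) ^ (a - 1) :=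
    hs.sum_le_tsum _ fun k _ => by positivity
  refine (Finset.sum_le_sum fun k _ => mul_le_of_le_one_right (by positivity)
    (Real.exp_le_one_iff.2 ?_)).trans (h1.trans (by linarith))
  have : 0 ≤ t * k := by positivity
  linarith

lemma sum_inv_mul_exp_le {t : ℝ} (ht : 0 < t) {T : Finset ℕ} (hT : ∀ k ∈ T, 1 ≤ k) :
    ∑ k ∈ T, (k : ℝ) ^ ((0 : ℝ) - 1) * Real.exp (-t * k) ≤ 2 + |Real.log t| := by
  refine (sum_rpow_mul_exp_le_split zero_le_one ht hT).trans ?_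
  rw [neg_zero, Real.rpow_zero]
  have key : ∑ k ∈ T.filter (fun k : ℕ => (k : ℝ) ≤ t⁻¹), (k : ℝ) ^ ((0 : ℝ) - 1) ≤
      1 + |Real.log t| := by
    have hT' : ∀ k ∈ T.filter (fun k : ℕ => (k : ℝ) ≤ t⁻¹), 1 ≤ k ∧ k ≤ ⌊t⁻¹⌋₊ := fun k hk =>
      ⟨hT k (Finset.mem_filter.1 hk).1, Nat.le_floor (Finset.mem_filter.1 hk).2⟩
    refine (sum_le_sum_range_succ hT' fun k => by positivity).trans ?_
    rcases le_or_gt 1 t⁻¹ with h | h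
    · have hh := harmonic_floor_le_one_add_log t⁻¹ h
      rw [Real.log_inv] at hh
      refine le_trans (le_of_eq ?_) (hh.trans (by linarith [neg_le_abs (Real.log t)]))
      simp [harmonic, Real.rpow_neg_one]
    · rw [Nat.floor_eq_zero.2 h]
      simp only [Finset.range_zero, Finset.sum_empty]
      positivity
  linarith

lemma rpow_le_two_rpow_abs_mul {p v y : ℝ} (hy : 0 < y) (h1 : y / 2 ≤ v) (h2 : v ≤ 2 * y) :
    v ^ p ≤ 2 ^ |p| * y ^ p := by
  rcases le_or_gt 0 p with hp | hp
  · rw [abs_of_nonneg hp, ← Real.mul_rpow (by norm_num) hy.le]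
    exact Real.rpow_le_rpow (by linarith) h2 hp
  · refine (Real.rpow_le_rpow_of_nonpos (by positivity) h1 hp.le).trans (le_of_eq ?_)
    rw [abs_of_neg hp, Real.div_rpow hy.le (by norm_num), Real.rpow_neg (by norm_num)]
    ring

lemma shift_term_le {d r : ℕ} (hr : 1 ≤ r) (p : ℝ) {ν : ℝ} (hν : 0 < ν) (x u : Fin d → ℤ)
    (hx : nInf x ≤ (r : ℝ) / 2) (hu : 1 ≤ nInf u) :
    vee (fun i => x i + (r : ℤ) * u i) ^ p *
        Real.exp (-ν * nInf (fun i => x i + (r : ℤ) * u i)) ≤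
      2 ^ |p| * (r * nInf u) ^ p *
        (Real.exp (-ν * r / 4) * Real.exp (-(ν * r / 4) * nInf u)) := by
  have hr' : (1 : ℝ) ≤ r := by exact_mod_cast hr
  have hlow := le_nInf_shift hr x u
  have hup := nInf_shift_le (r := r) x u
  set w := nInf (fun i => x i + (r : ℤ) * u i) with hw
  set n := nInf u
  have hrn : (r : ℝ) ≤ r * n := le_mul_of_one_le_right (by linarith) hu
  have hwl : r * n / 2 ≤ w := by linarith
  have hpow : vee (fun i => x i + (r : ℤ) * u i) ^ p ≤ 2 ^ |p| * (r * n) ^ p := by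
    apply rpow_le_two_rpow_abs_mul (by linarith)
    · exact hwl.trans (le_max_right _ _)
    · exact max_le (by linarith) (by linarith)
  refine mul_le_mul hpow ?_ (Real.exp_pos _).le (by positivity)
  rw [← Real.exp_add, Real.exp_le_exp]
  have h1 := mul_le_mul_of_nonneg_left hwl hν.le
  have h2 := mul_le_mul_of_nonneg_left hrn hν.le
  linarith

/-- Reduction of the lattice sum to the one-dimensional sums `∑ k^{a-1} e^{-νrk/4}`. -/
lemma tsum_shift_le {d : ℕ} (hd : 1 ≤ d) (a : ℝ) {r : ℕ} (hr : 1 ≤ r) {ν : ℝ} (hν : 0 < ν)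
    (x : Fin d → ℤ) (hx : nInf x ≤ (r : ℝ) / 2) {S : ℝ}
    (hS : ∀ T : Finset ℕ, (∀ k ∈ T, 1 ≤ k) →
      ∑ k ∈ T, (k : ℝ) ^ (a - 1) * Real.exp (-(ν * r / 4) * k) ≤ S) :
    (∑' u : {u : Fin d → ℤ // u ≠ 0},
        vee (fun i => x i + (r : ℤ) * (u : Fin d → ℤ) i) ^ (-((d : ℝ) - a)) *
          Real.exp (-ν * nInf (fun i => x i + (r : ℤ) * (u : Fin d → ℤ) i))) ≤
      2 ^ |-((d : ℝ) - a)| * (d * (2 * 3 ^ (d - 1))) * Real.exp (-ν * r / 4) *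
        (r : ℝ) ^ (-((d : ℝ) - a)) * S := by
  have hr' : (0 : ℝ) < r := by exact_mod_cast hr
  have hS0 : 0 ≤ S := by simpa using hS ∅ (by simp)
  set p := -((d : ℝ) - a) with hp
  refine Real.tsum_le_of_sum_le (fun u => ?_) fun s => ?_
  · have : 0 ≤ vee (fun i => x i + (r : ℤ) * u.1 i) := zero_le_one.trans (le_max_left _ _)
    positivity
  obtain ⟨T, hT, hsum⟩ := exists_radial_sum_le d s
  let F : ℕ → ℝ := fun k => 2 ^ |p| * (r * k) ^ p *
    (Real.exp (-ν * r / 4) * Real.exp (-(ν * r / 4) * k))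
  have hterm : ∀ u ∈ s, vee (fun i => x i + (r : ℤ) * u.1 i) ^ p *
      Real.exp (-ν * nInf (fun i => x i + (r : ℤ) * u.1 i)) ≤
        F (Finset.univ.sup fun i => (u.1 i).natAbs) := fun u _ => by
    refine shift_term_le hr p hν x u.1 hx ?_
    obtain ⟨i, hi⟩ := Function.ne_iff.1 u.2
    refine le_trans ?_ (abs_le_nInf u.1 i)
    exact_mod_cast Int.one_le_abs hi
  refine (Finset.sum_le_sum hterm).trans ((hsum F fun k => by positivity).trans ?_)
  refine le_trans (le_of_eq ?_) (mul_le_mul_of_nonneg_left (hS T hT) (by positivity))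
  rw [Finset.mul_sum]
  refine Finset.sum_congr rfl fun k hk => ?_
  have hk0 : (0 : ℝ) < k := by exact_mod_cast hT k hk
  have e : (k : ℝ) ^ (a - 1) = k ^ (d - 1) * (k : ℝ) ^ p := by
    rw [← Real.rpow_natCast, ← Real.rpow_add hk0, Nat.cast_sub hd, hp]
    congr 1; push_cast; ring
  simp only [F]
  rw [e, Real.mul_rpow hr'.le hk0.le]
  push_cast
  rw [mul_pow]
  ring

/-- for `‖x‖_∞ ≤ r/2` and `ν > 0`,
`Σ_{u≠0} ⟨x+ru⟩^{-(d-a)} e^{-ν‖x+ru‖_∞} ≤ C e^{-νr/4} r^{-(d+a_-)} ν^{-a_+}`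
(with a logarithmic correction when `a = 0`), `C` depending only on `a` and `d`. -/
theorem statement15 (d : ℕ) (hd : 1 ≤ d) (a : ℝ) :
    ∃ C : ℝ, 0 < C ∧
      ∀ r : ℕ, 1 ≤ r → ∀ ν : ℝ, 0 < ν → ∀ x : Fin d → ℤ, nInf x ≤ (r : ℝ) / 2 →
        (a ≠ 0 →
          (∑' u : {u : Fin d → ℤ // u ≠ 0},
              vee (fun i => x i + (r : ℤ) * (u : Fin d → ℤ) i) ^ (-((d : ℝ) - a)) *
                Real.exp (-ν * nInf (fun i => x i + (r : ℤ) * (u : Fin d → ℤ) i))) ≤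
            C * Real.exp (-ν * r / 4) * (r : ℝ) ^ (-((d : ℝ) + max (-a) 0)) *
              ν ^ (-max a 0)) ∧
        (a = 0 →
          (∑' u : {u : Fin d → ℤ // u ≠ 0},
              vee (fun i => x i + (r : ℤ) * (u : Fin d → ℤ) i) ^ (-((d : ℝ) - a)) *
                Real.exp (-ν * nInf (fun i => x i + (r : ℤ) * (u : Fin d → ℤ) i))) ≤
            C * Real.exp (-ν * r / 4) * (r : ℝ) ^ (-(d : ℝ)) *
              (1 + |Real.log (ν * r)|)) := by
  have hd0 : (0 : ℝ) < d := by exact_mod_cast hd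
  set K : ℝ := 2 ^ |-((d : ℝ) - a)| * (d * (2 * 3 ^ (d - 1))) with hK
  have hK0 : 0 < K := by positivity
  rcases lt_trichotomy a 0 with ha | ha | ha
  · obtain ⟨C, hC, hbound⟩ := exists_sum_rpow_mul_exp_le_of_neg ha
    refine ⟨K * C, by positivity, fun r hr ν hν x hx => ⟨fun _ => ?_, fun h => absurd h ha.ne⟩⟩
    have hr' : (0 : ℝ) < r := by exact_mod_cast hr
    refine (tsum_shift_le hd a hr hν x hx fun T _ =>
      hbound (ν * r / 4) (by positivity) T).trans (le_of_eq ?_)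
    rw [max_eq_left (by linarith : (0 : ℝ) ≤ -a), max_eq_right ha.le, neg_zero, Real.rpow_zero,
      ← sub_eq_add_neg]
    ring
  · refine ⟨K * 4, by positivity, fun r hr ν hν x hx => ⟨fun h => absurd ha h, fun _ => ?_⟩⟩
    subst ha
    have hr' : (0 : ℝ) < r := by exact_mod_cast hr
    refine (tsum_shift_le hd 0 hr hν x hx fun T hT =>
      sum_inv_mul_exp_le (show 0 < ν * r / 4 by positivity) hT).trans ?_
    have hlog : 2 + |Real.log (ν * r / 4)| ≤ 4 * (1 + |Real.log (ν * r)|) := by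
      rw [Real.log_div (by positivity) (by norm_num)]
      have h4 : Real.log 4 = 2 * Real.log 2 := by
        rw [show (4 : ℝ) = 2 ^ 2 by norm_num, Real.log_pow]; norm_num
      have h2 := Real.log_two_lt_d9
      have h2' := Real.log_two_gt_d9
      have := abs_sub (Real.log (ν * r)) (Real.log 4)
      rw [abs_of_pos (show 0 < Real.log 4 by linarith)] at this
      linarith [abs_nonneg (Real.log (ν * r))]
    refine (mul_le_mul_of_nonneg_left hlog (by positivity)).trans (le_of_eq ?_)
    rw [hK, sub_zero]
    ring
  · obtain ⟨C, hC, hbound⟩ := exists_sum_rpow_mul_exp_le_of_pos ha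
    refine ⟨K * C * 4 ^ a, by positivity, fun r hr ν hν x hx =>
      ⟨fun _ => ?_, fun h => absurd h ha.ne'⟩⟩
    have hr' : (0 : ℝ) < r := by exact_mod_cast hr
    refine (tsum_shift_le hd a hr hν x hx fun T hT =>
      hbound (ν * r / 4) (by positivity) T hT).trans (le_of_eq ?_)
    rw [max_eq_right (by linarith : -a ≤ (0 : ℝ)), max_eq_left ha.le, add_zero,
      Real.div_rpow (by positivity) (by norm_num), Real.mul_rpow hν.le hr'.le,
      Real.rpow_neg (by norm_num : (0 : ℝ) ≤ 4),
      show -(d : ℝ) = -((d : ℝ) - a) + -a by ring, Real.rpow_add hr', div_inv_eq_mul]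
    ring
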